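/- Suppose the gap assumption holds at H(V) with constant δ > 0 for a given V ∈ ℝⁿ, and Assumption (xc-bound) holds with constant θ. Then the Jacobian of F_φ at V satisfies ‖∂_V F_φ(V)[z]‖₂ ≤ (1/δ)‖z‖₂ for all z ∈ ℝⁿ, and the Jacobian of the composite map V ↦ 𝒱(F_φ(V)) satisfies ‖∂_V 𝒱(F_φ(V))[z]‖₂ ≤ ((‖L†‖₂ + θ)/δ)‖z‖₂ for all z ∈ ℝⁿ. -/

import Mathlib

open Matrix Filter

/-- Euclidean (ℓ²) norm of a vector in `Fin n → ℝ`. -/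
noncomputable def vnorm {n : ℕ} (v : Fin n → ℝ) : ℝ := Real.sqrt (∑ i, v i ^ 2)

/-- Spectral (ℓ² operator) norm of a real matrix. -/
noncomputable def specNorm {m k : ℕ} (A : Matrix (Fin m) (Fin k) ℝ) : ℝ :=
  ‖LinearMap.toContinuousLinearMap (Matrix.toEuclideanLin A)‖

/-- Eigenvalues of a real symmetric matrix, sorted in ascending order
(junk value `0` if the matrix is not symmetric). -/
noncomputable def eig {n : ℕ} (A : Matrix (Fin n) (Fin n) ℝ) : Fin n → ℝ :=
  if h : A.IsHermitian then h.eigenvalues ∘ (Tuple.sort h.eigenvalues) else 0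

/-- Orthogonal spectral projector onto the invariant subspace spanned by eigenvectors
associated with the `p` smallest eigenvalues of a symmetric matrix. -/
noncomputable def specProj {n : ℕ} (p : ℕ) (A : Matrix (Fin n) (Fin n) ℝ) :
    Matrix (Fin n) (Fin n) ℝ :=
  if h : A.IsHermitian then
    (h.eigenvectorUnitary : Matrix (Fin n) (Fin n) ℝ) *
      Matrix.diagonal (fun k => if (((Tuple.sort h.eigenvalues).symm k : Fin n) : ℕ) < p
        then (1 : ℝ) else 0) *
      star (h.eigenvectorUnitary : Matrix (Fin n) (Fin n) ℝ)
  else 0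

/-- The Hamiltonian `H(V) = (1/2)L + V_ion + Diag(V)`. -/
noncomputable def Hmat {n : ℕ} (L Vion : Matrix (Fin n) (Fin n) ℝ) (V : Fin n → ℝ) :
    Matrix (Fin n) (Fin n) ℝ :=
  (1 / 2 : ℝ) • L + Vion + Matrix.diagonal V

/-- `F_φ(V) = diag(P_p(V))`. -/
noncomputable def Fphi {n : ℕ} (p : ℕ) (L Vion : Matrix (Fin n) (Fin n) ℝ) (V : Fin n → ℝ) :
    Fin n → ℝ :=
  fun i => specProj p (Hmat L Vion V) i i

/-- The potential map `𝒱(ρ) = L†ρ + μ_xc(ρ)ᵀe`, with `m ρ = μ_xc(ρ)ᵀe`. -/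
noncomputable def potMap {n : ℕ} (Ld : Matrix (Fin n) (Fin n) ℝ)
    (m : (Fin n → ℝ) → (Fin n → ℝ)) (ρ : Fin n → ℝ) : Fin n → ℝ :=
  Ld.mulVec ρ + m ρ

open Topology

section EuclideanNorm

variable {n : ℕ}

lemma vnorm_eq_norm_toLp (v : Fin n → ℝ) : vnorm v = ‖WithLp.toLp 2 v‖ := by
  simp [vnorm, EuclideanSpace.norm_eq]

lemma vnorm_nonneg (v : Fin n → ℝ) : 0 ≤ vnorm v := Real.sqrt_nonneg _

lemma vnorm_zero : vnorm (0 : Fin n → ℝ) = 0 := by simp [vnorm]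

lemma vnorm_smul (c : ℝ) (v : Fin n → ℝ) : vnorm (c • v) = |c| * vnorm v := by
  simp [vnorm_eq_norm_toLp, WithLp.toLp_smul, norm_smul]

lemma vnorm_add_le (v w : Fin n → ℝ) : vnorm (v + w) ≤ vnorm v + vnorm w := by
  simpa [vnorm_eq_norm_toLp] using norm_add_le (WithLp.toLp 2 v) (WithLp.toLp 2 w)

lemma continuous_vnorm : Continuous (vnorm : (Fin n → ℝ) → ℝ) := by
  unfold vnorm
  fun_prop

lemma abs_apply_le_vnorm (v : Fin n → ℝ) (i : Fin n) : |v i| ≤ vnorm v := by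
  rw [vnorm_eq_norm_toLp]
  simpa using PiLp.norm_apply_le (WithLp.toLp 2 v) i

lemma vnorm_mulVec_le (A : Matrix (Fin n) (Fin n) ℝ) (v : Fin n → ℝ) :
    vnorm (A.mulVec v) ≤ specNorm A * vnorm v := by
  have h := (LinearMap.toContinuousLinearMap (Matrix.toEuclideanLin A)).le_opNorm
    (WithLp.toLp 2 v)
  simpa [vnorm_eq_norm_toLp, specNorm, Matrix.toLpLin_toLp] using h

/-- Mean value inequality for the Euclidean norm. -/
lemma vnorm_sub_le_of_fderiv_le {f : (Fin n → ℝ) → (Fin n → ℝ)} {C : ℝ}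
    (hf : Differentiable ℝ f) (hC : ∀ x z, vnorm (fderiv ℝ f x z) ≤ C * vnorm z)
    (x y : Fin n → ℝ) : vnorm (f x - f y) ≤ C * vnorm (x - y) := by
  let e : (Fin n → ℝ) →L[ℝ] EuclideanSpace ℝ (Fin n) :=
    (EuclideanSpace.equiv (Fin n) ℝ).symm.toContinuousLinearMap
  have he : ∀ v, ‖e v‖ = vnorm v := fun v => (vnorm_eq_norm_toLp v).symm
  have hd : ∀ t : ℝ, HasDerivAt (fun t : ℝ => e (f (y + t • (x - y))))
      (e (fderiv ℝ f (y + t • (x - y)) (x - y))) t := by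
    intro t
    have h1 : HasDerivAt (fun t : ℝ => y + t • (x - y)) (x - y) t := by
      simpa using ((hasDerivAt_id t).smul_const (x - y)).const_add y
    exact e.hasFDerivAt.comp_hasDerivAt t ((hf _).hasFDerivAt.comp_hasDerivAt t h1)
  have h := norm_image_sub_le_of_norm_deriv_le_segment_01'
    (fun t _ => (hd t).hasDerivWithinAt) (C := C * vnorm (x - y))
    (fun t _ => by rw [he]; exact hC _ _)
  simpa [← map_sub, he] using h

/-- A pointwise asymptotic Lipschitz bound at `x` controls the derivative at `x`. -/
lemma vnorm_fderiv_le_of_eventually {f : (Fin n → ℝ) → (Fin n → ℝ)} {x : Fin n → ℝ} {C : ℝ}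
    (hC : 0 ≤ C) {c : (Fin n → ℝ) → ℝ} (hc : Tendsto c (𝓝 x) (𝓝 C))
    (hf : ∀ᶠ y in 𝓝 x, vnorm (f y - f x) ≤ c y * vnorm (y - x)) (z : Fin n → ℝ) :
    vnorm (fderiv ℝ f x z) ≤ C * vnorm z := by
  by_cases hd : DifferentiableAt ℝ f x
  · have hline := hd.hasFDerivAt.hasLineDerivAt z
    have hslope := (continuous_vnorm.tendsto _).comp
      (hasDerivAt_iff_tendsto_slope_zero.1 hline)
    have hpath : Tendsto (fun t : ℝ => x + t • z) (𝓝[≠] 0) (𝓝 x) := by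
      have : Tendsto (fun t : ℝ => x + t • z) (𝓝 0) (𝓝 (x + (0 : ℝ) • z)) :=
        Continuous.tendsto (by fun_prop) 0
      simpa using this.mono_left nhdsWithin_le_nhds
    refine le_of_tendsto_of_tendsto hslope ((hc.comp hpath).mul_const (vnorm z)) ?_
    filter_upwards [hpath.eventually hf, self_mem_nhdsWithin] with t ht ht0
    have ht0 : 0 < |t| := abs_pos.2 ht0
    simp only [Function.comp_apply, zero_add, zero_smul, add_zero, vnorm_smul, abs_inv,
      add_sub_cancel_left] at ht ⊢
    rw [inv_mul_le_iff₀ ht0]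
    linarith
  · rw [fderiv_zero_of_not_differentiableAt hd]
    simpa [vnorm_zero] using mul_nonneg hC (vnorm_nonneg z)

end EuclideanNorm

section SpectralPerturbation

variable {n : ℕ}

/-- A symmetric matrix is diagonalized by an orthogonal matrix listing the eigenvalues in
ascending order, and this matrix also diagonalizes the spectral projectors. -/
lemma exists_orthogonal_diagonalization {A : Matrix (Fin n) (Fin n) ℝ} (hA : A.IsHermitian) :
    Monotone (eig A) ∧ ∃ U : Matrix (Fin n) (Fin n) ℝ, Uᵀ * U = 1 ∧ U * Uᵀ = 1 ∧
      A = U * diagonal (eig A) * Uᵀ ∧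
      ∀ p : ℕ, specProj p A =
        U * diagonal (fun k : Fin n => if (k : ℕ) < p then (1 : ℝ) else 0) * Uᵀ := by
  have heig : eig A = hA.eigenvalues ∘ Tuple.sort hA.eigenvalues := dif_pos hA
  set σ := Tuple.sort hA.eigenvalues
  refine ⟨heig ▸ Tuple.monotone_sort _, ?_⟩
  let W : Matrix (Fin n) (Fin n) ℝ := hA.eigenvectorUnitary
  have hW : Wᵀ * W = 1 := by
    have := Unitary.coe_star_mul_self hA.eigenvectorUnitary
    rwa [star_eq_conjTranspose, conjTranspose_eq_transpose_of_trivial] at this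
  have hW' : W * Wᵀ = 1 := mul_eq_one_comm.1 hW
  have hconj : ∀ d : Fin n → ℝ, W.submatrix id σ * diagonal (d ∘ σ) * (W.submatrix id σ)ᵀ
      = W * diagonal d * Wᵀ := by
    intro d
    rw [← submatrix_diagonal_equiv, transpose_submatrix, submatrix_mul_equiv,
      submatrix_mul_equiv, submatrix_id_id]
  refine ⟨W.submatrix id σ, ?_, ?_, ?_, ?_⟩
  · rw [transpose_submatrix, submatrix_mul _ _ _ id _ Function.bijective_id |>.symm, hW,
      submatrix_one_equiv]
  · rw [transpose_submatrix, submatrix_mul_equiv, hW', submatrix_id_id]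
  · rw [heig, hconj]
    have := hA.spectral_theorem
    simpa [Unitary.conjStarAlgAut_apply, star_eq_conjTranspose,
      conjTranspose_eq_transpose_of_trivial, Function.comp_def] using this
  · intro p
    have := hconj (fun k => if ((σ.symm k : Fin n) : ℕ) < p then 1 else 0)
    simp only [Function.comp_def, Equiv.symm_apply_apply] at this
    rw [this, specProj, dif_pos hA, star_eq_conjTranspose, conjTranspose_eq_transpose_of_trivial]

lemma dotProduct_conj_diagonal_mulVec (U : Matrix (Fin n) (Fin n) ℝ) (d x : Fin n → ℝ) :
    x ⬝ᵥ (U * diagonal d * Uᵀ) *ᵥ x = ∑ k, d k * (Uᵀ *ᵥ x) k ^ 2 := by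
  rw [← mulVec_mulVec, ← mulVec_mulVec, dotProduct_mulVec, ← mulVec_transpose, dotProduct]
  refine Finset.sum_congr rfl fun k _ => ?_
  rw [mulVec_diagonal]
  ring

lemma sum_sq_transpose_mulVec {U : Matrix (Fin n) (Fin n) ℝ} (hU : U * Uᵀ = 1)
    (x : Fin n → ℝ) : ∑ k, (Uᵀ *ᵥ x) k ^ 2 = ∑ k, x k ^ 2 := by
  have h := dotProduct_conj_diagonal_mulVec U (fun _ => 1) x
  simp only [diagonal_one, mul_one, hU, one_mulVec, one_mul] at h
  rw [← h, dotProduct]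
  exact Finset.sum_congr rfl fun k _ => by ring

/-- Weyl's monotonicity: if `B ≤ A + d` as quadratic forms, then each ordered eigenvalue of `B`
exceeds that of `A` by at most `d`. -/
lemma eig_le_eig_add {A B : Matrix (Fin n) (Fin n) ℝ} (hA : A.IsHermitian)
    (hB : B.IsHermitian) {d : ℝ}
    (h : ∀ x : Fin n → ℝ, x ⬝ᵥ B *ᵥ x ≤ x ⬝ᵥ A *ᵥ x + d * ∑ k, x k ^ 2) (j : Fin n) :
    eig B j ≤ eig A j + d := by
  obtain ⟨hmonoA, U, -, hU, hAU, -⟩ := exists_orthogonal_diagonalization hA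
  obtain ⟨hmonoB, W, -, hW, hBW, -⟩ := exists_orthogonal_diagonalization hB
  let N : Matrix (Fin n) (Fin n) ℝ := fun k => if k < j then Wᵀ k else if j < k then Uᵀ k else 0
  have hN : N.det = 0 := det_eq_zero_of_row_eq_zero j fun i => by simp [N]
  obtain ⟨x, hx0, hx⟩ := exists_mulVec_eq_zero_iff.2 hN
  have hxW : ∀ k < j, (Wᵀ *ᵥ x) k = 0 := fun k hk => by
    simpa [N, mulVec, hk] using congrFun hx k
  have hxU : ∀ k, j < k → (Uᵀ *ᵥ x) k = 0 := fun k hk => by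
    simpa [N, mulVec, hk, hk.not_gt] using congrFun hx k
  have hpos : 0 < ∑ k, x k ^ 2 := by
    obtain ⟨i, hi⟩ := Function.ne_iff.1 hx0
    exact Finset.sum_pos' (fun _ _ => sq_nonneg _) ⟨i, Finset.mem_univ _, by
      have : x i ≠ 0 := hi
      positivity⟩
  have hlow : eig B j * ∑ k, x k ^ 2 ≤ x ⬝ᵥ B *ᵥ x := by
    conv_rhs => rw [hBW]
    rw [dotProduct_conj_diagonal_mulVec, ← sum_sq_transpose_mulVec hW, Finset.mul_sum]
    refine Finset.sum_le_sum fun k _ => ?_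
    rcases lt_or_ge k j with hk | hk
    · simp [hxW k hk]
    · exact mul_le_mul_of_nonneg_right (hmonoB hk) (sq_nonneg _)
  have hupp : x ⬝ᵥ A *ᵥ x ≤ eig A j * ∑ k, x k ^ 2 := by
    conv_lhs => rw [hAU]
    rw [dotProduct_conj_diagonal_mulVec, ← sum_sq_transpose_mulVec hU, Finset.mul_sum]
    refine Finset.sum_le_sum fun k _ => ?_
    rcases lt_or_ge j k with hk | hk
    · simp [hxU k hk]
    · exact mul_le_mul_of_nonneg_right (hmonoA hk) (sq_nonneg _)
  have := h x
  refine le_of_mul_le_mul_right ?_ hpos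
  linarith

lemma sum_sq_eq_trace (X : Matrix (Fin n) (Fin n) ℝ) :
    ∑ i, ∑ j, X i j ^ 2 = (Xᵀ * X).trace := by
  rw [Finset.sum_comm]
  simp [trace, mul_apply, sq]

lemma sum_sq_orthogonal_conj {U W : Matrix (Fin n) (Fin n) ℝ} (hU : U * Uᵀ = 1)
    (hW : W * Wᵀ = 1) (X : Matrix (Fin n) (Fin n) ℝ) :
    ∑ i, ∑ j, (Uᵀ * X * W) i j ^ 2 = ∑ i, ∑ j, X i j ^ 2 := by
  rw [sum_sq_eq_trace, sum_sq_eq_trace]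
  have : (Uᵀ * X * W)ᵀ * (Uᵀ * X * W) = Wᵀ * (Xᵀ * (U * Uᵀ) * X * W) := by
    simp only [transpose_mul, transpose_transpose, Matrix.mul_assoc]
  rw [this, hU, trace_mul_comm, Matrix.mul_assoc _ W, hW, Matrix.mul_one, Matrix.mul_one]

/-- Davis–Kahan bound in the Frobenius norm: `g` separates the lowest `p` eigenvalues of each
matrix from the remaining eigenvalues of the other. -/
lemma sum_sq_specProj_sub_le {A B : Matrix (Fin n) (Fin n) ℝ} (hA : A.IsHermitian)
    (hB : B.IsHermitian) {p : ℕ} {g : ℝ} (hg : 0 ≤ g)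
    (hAB : ∀ i j : Fin n, p ≤ (i : ℕ) → (j : ℕ) < p → g ≤ eig A i - eig B j)
    (hBA : ∀ i j : Fin n, p ≤ (i : ℕ) → (j : ℕ) < p → g ≤ eig B i - eig A j) :
    g ^ 2 * ∑ i, ∑ j, (specProj p B - specProj p A) i j ^ 2 ≤ ∑ i, ∑ j, (B - A) i j ^ 2 := by
  obtain ⟨-, U, hU', hU, hAU, hPA⟩ := exists_orthogonal_diagonalization hA
  obtain ⟨-, W, hW', hW, hBW, hPB⟩ := exists_orthogonal_diagonalization hB
  have hdiff : ∀ a b : Fin n → ℝ, ∀ i j,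
      (Uᵀ * (W * diagonal b * Wᵀ - U * diagonal a * Uᵀ) * W) i j
        = (b j - a i) * (Uᵀ * W) i j := by
    intro a b i j
    have : Uᵀ * (W * diagonal b * Wᵀ - U * diagonal a * Uᵀ) * W
        = Uᵀ * W * diagonal b * (Wᵀ * W) - (Uᵀ * U) * (diagonal a * (Uᵀ * W)) := by
      simp only [Matrix.mul_sub, Matrix.sub_mul, Matrix.mul_assoc]
    rw [this, hU', hW', Matrix.mul_one, Matrix.one_mul, Matrix.sub_apply, mul_diagonal,
      diagonal_mul]
    ring
  rw [← sum_sq_orthogonal_conj hU hW, ← sum_sq_orthogonal_conj hU hW (B - A), Finset.mul_sum]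
  refine Finset.sum_le_sum fun i _ => ?_
  rw [Finset.mul_sum]
  refine Finset.sum_le_sum fun j _ => ?_
  have hBAij := hdiff (eig A) (eig B) i j
  rw [← hAU, ← hBW] at hBAij
  rw [hPA, hPB, hdiff, hBAij, mul_pow, mul_pow, ← mul_assoc]
  refine mul_le_mul_of_nonneg_right ?_ (sq_nonneg _)
  rcases lt_or_ge (i : ℕ) p with hi | hi <;> rcases lt_or_ge (j : ℕ) p with hj | hj
  · simp [hi, hj, sq_nonneg]
  · have := hBA j i hj hi
    simp only [hi, hj.not_gt, if_true, if_false]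
    nlinarith
  · have := hAB i j hi hj
    simp only [hj, hi.not_gt, if_true, if_false]
    nlinarith
  · simp [hi.not_gt, hj.not_gt, sq_nonneg]

end SpectralPerturbation

section Hamiltonian

variable {n : ℕ} {L Vion : Matrix (Fin n) (Fin n) ℝ}

lemma isHermitian_Hmat (hL : L.IsHermitian) (hVion : Vion.IsHermitian) (V : Fin n → ℝ) :
    (Hmat L Vion V).IsHermitian := by
  have hL' : Lᵀ = L := hL
  have hV' : Vionᵀ = Vion := hVion
  simp [Matrix.IsHermitian, Hmat, conjTranspose_eq_transpose_of_trivial, hL', hV']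

lemma Hmat_sub_Hmat (L Vion : Matrix (Fin n) (Fin n) ℝ) (V W : Fin n → ℝ) :
    Hmat L Vion W - Hmat L Vion V = diagonal (W - V) := by
  rw [Hmat, Hmat, add_sub_add_left_eq_sub, diagonal_sub]
  rfl

lemma eig_Hmat_le (hL : L.IsHermitian) (hVion : Vion.IsHermitian) (V W : Fin n → ℝ)
    (j : Fin n) : eig (Hmat L Vion W) j ≤ eig (Hmat L Vion V) j + vnorm (W - V) := by
  refine eig_le_eig_add (isHermitian_Hmat hL hVion V) (isHermitian_Hmat hL hVion W) ?_ j
  intro x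
  rw [← sub_le_iff_le_add', ← dotProduct_sub, ← sub_mulVec, Hmat_sub_Hmat, dotProduct,
    Finset.mul_sum]
  refine Finset.sum_le_sum fun k _ => ?_
  have := (le_abs_self _).trans (abs_apply_le_vnorm (W - V) k)
  rw [mulVec_diagonal]
  nlinarith [mul_le_mul_of_nonneg_right this (sq_nonneg (x k))]

lemma vnorm_sub_comm (v w : Fin n → ℝ) : vnorm (v - w) = vnorm (w - v) := by
  simp only [vnorm_eq_norm_toLp, WithLp.toLp_sub, norm_sub_rev]

/-- Quantitative perturbation bound for the density map. -/
lemma vnorm_Fphi_sub_le {p : ℕ} (hpn : p < n) (hp' : p - 1 < n) (hL : L.IsHermitian)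
    (hVion : Vion.IsHermitian) {V W : Fin n → ℝ} {δ : ℝ}
    (hgap : δ ≤ eig (Hmat L Vion V) ⟨p, hpn⟩ - eig (Hmat L Vion V) ⟨p - 1, hp'⟩)
    (hW : vnorm (W - V) < δ) :
    vnorm (Fphi p L Vion W - Fphi p L Vion V) ≤ (δ - vnorm (W - V))⁻¹ * vnorm (W - V) := by
  have hA := isHermitian_Hmat hL hVion V
  have hB := isHermitian_Hmat hL hVion W
  have hmonoA := (exists_orthogonal_diagonalization hA).1
  have hmonoB := (exists_orthogonal_diagonalization hB).1
  set d := vnorm (W - V) with hd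
  have hBp := eig_Hmat_le hL hVion V W ⟨p - 1, hp'⟩
  have hAp := eig_Hmat_le hL hVion W V ⟨p, hpn⟩
  rw [vnorm_sub_comm V W, ← hd] at hAp
  rw [← hd] at hBp
  have hup : ∀ {f : Fin n → ℝ}, Monotone f → ∀ i : Fin n, p ≤ (i : ℕ) → f ⟨p, hpn⟩ ≤ f i :=
    fun hf i hi => hf (Fin.mk_le_of_le_val hi)
  have hlow : ∀ {f : Fin n → ℝ}, Monotone f → ∀ j : Fin n, (j : ℕ) < p →
      f j ≤ f ⟨p - 1, hp'⟩ := fun hf j hj => hf (Fin.le_def.2 (Nat.le_sub_one_of_lt hj))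
  have hg : 0 < δ - d := sub_pos.2 hW
  have hDK := sum_sq_specProj_sub_le hA hB hg.le
    (fun i j hi hj => by linarith [hup hmonoA i hi, hlow hmonoB j hj])
    (fun i j hi hj => by linarith [hup hmonoB i hi, hlow hmonoA j hj])
  have hfrob : ∑ i, ∑ j, (Hmat L Vion W - Hmat L Vion V) i j ^ 2 = ∑ i, (W - V) i ^ 2 := by
    rw [Hmat_sub_Hmat]
    simp [diagonal_apply]
  have hdiag : ∑ i, (Fphi p L Vion W - Fphi p L Vion V) i ^ 2 ≤
      ∑ i, ∑ j, (specProj p (Hmat L Vion W) - specProj p (Hmat L Vion V)) i j ^ 2 :=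
    Finset.sum_le_sum fun i _ => Finset.single_le_sum
      (f := fun j => (specProj p (Hmat L Vion W) - specProj p (Hmat L Vion V)) i j ^ 2)
      (fun _ _ => sq_nonneg _) (Finset.mem_univ i)
  rw [le_inv_mul_iff₀ hg]
  refine Real.le_sqrt_of_sq_le ?_
  rw [mul_pow, vnorm, Real.sq_sqrt (Finset.sum_nonneg fun _ _ => sq_nonneg _), ← hfrob]
  exact (mul_le_mul_of_nonneg_left hdiag (sq_nonneg _)).trans hDK

end Hamiltonian

/-- Lemma 4.1 of the paper: under the gap assumption with constant `δ` and
the xc-bound assumption with constant `θ`, the Jacobians of `F_φ` and of `𝒱 ∘ F_φ` at `V`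
are bounded in the ℓ² operator norm by `1/δ` and `(‖L†‖₂ + θ)/δ`, respectively. -/
theorem Fphi_jacobian_bounds {n p : ℕ} (hp : 1 ≤ p) (hpn : p < n)
    (L Vion Ld : Matrix (Fin n) (Fin n) ℝ)
    (hL : L.IsHermitian) (hVion : Vion.IsHermitian)
    (hMP1 : L * Ld * L = L) (hMP2 : Ld * L * Ld = Ld)
    (hMP3 : (L * Ld)ᵀ = L * Ld) (hMP4 : (Ld * L)ᵀ = Ld * L)
    (m : (Fin n → ℝ) → (Fin n → ℝ)) (θ : ℝ)
    (hm1 : ContDiff ℝ 1 m)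
    (hmθ : ∀ (ρ : Fin n → ℝ) (z : Fin n → ℝ), vnorm (fderiv ℝ m ρ z) ≤ θ * vnorm z)
    (V : Fin n → ℝ) (δ : ℝ) (hδ : 0 < δ)
    (hgap : eig (Hmat L Vion V) ⟨p, hpn⟩ - eig (Hmat L Vion V) ⟨p - 1, by omega⟩ ≥ δ) :
    (∀ z : Fin n → ℝ,
        vnorm (fderiv ℝ (Fphi p L Vion) V z) ≤ (1 / δ) * vnorm z) ∧
    (∀ z : Fin n → ℝ,
        vnorm (fderiv ℝ (fun W => potMap Ld m (Fphi p L Vion W)) V z)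
          ≤ ((specNorm Ld + θ) / δ) * vnorm z) := by
  have hmem : ∀ᶠ W in 𝓝 V, vnorm (W - V) < δ := by
    refine (Continuous.tendsto' (f := fun W => vnorm (W - V)) ?_ V 0 ?_).eventually_lt_const hδ
    · exact continuous_vnorm.comp (by fun_prop)
    · rw [sub_self, vnorm_zero]
  have hlim : Tendsto (fun W => (δ - vnorm (W - V))⁻¹) (𝓝 V) (𝓝 (1 / δ)) := by
    have h : Tendsto (fun W => δ - vnorm (W - V)) (𝓝 V) (𝓝 δ) := by
      refine Continuous.tendsto' ?_ V δ ?_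
      · exact continuous_const.sub (continuous_vnorm.comp (by fun_prop))
      · rw [sub_self, vnorm_zero, sub_zero]
    simpa using h.inv₀ hδ.ne'
  have hF : ∀ᶠ W in 𝓝 V, vnorm (Fphi p L Vion W - Fphi p L Vion V)
      ≤ (δ - vnorm (W - V))⁻¹ * vnorm (W - V) :=
    hmem.mono fun W hW => vnorm_Fphi_sub_le hpn _ hL hVion hgap hW
  have hθ : 0 ≤ θ := by
    have h := (vnorm_nonneg _).trans (hmθ 0 (Pi.single ⟨p, hpn⟩ 1))
    have h1 : vnorm (Pi.single ⟨p, hpn⟩ 1 : Fin n → ℝ) = 1 := by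
      simp [vnorm_eq_norm_toLp]
    rwa [h1, mul_one] at h
  have hK : 0 ≤ specNorm Ld + θ := add_nonneg (norm_nonneg _) hθ
  refine ⟨vnorm_fderiv_le_of_eventually (by positivity) hlim hF,
    vnorm_fderiv_le_of_eventually (by positivity)
      (c := fun W => (specNorm Ld + θ) * (δ - vnorm (W - V))⁻¹) ?_ ?_⟩
  · simpa [div_eq_mul_inv] using hlim.const_mul (specNorm Ld + θ)
  · filter_upwards [hF] with W hW
    set ρ := Fphi p L Vion W
    set ρ₀ := Fphi p L Vion V
    calc vnorm (potMap Ld m ρ - potMap Ld m ρ₀)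
        = vnorm (Ld *ᵥ (ρ - ρ₀) + (m ρ - m ρ₀)) := by
          rw [potMap, potMap, add_sub_add_comm, mulVec_sub]
      _ ≤ specNorm Ld * vnorm (ρ - ρ₀) + θ * vnorm (ρ - ρ₀) :=
          (vnorm_add_le _ _).trans (add_le_add (vnorm_mulVec_le _ _)
            (vnorm_sub_le_of_fderiv_le (hm1.differentiable one_ne_zero) hmθ _ _))
      _ = (specNorm Ld + θ) * vnorm (ρ - ρ₀) := by ring
      _ ≤ (specNorm Ld + θ) * (δ - vnorm (W - V))⁻¹ * vnorm (W - V) := by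
          rw [mul_assoc]
          exact mul_le_mul_of_nonneg_left hW hK
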